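/- Let n ≥ 8 and 4 ≤ k ≤ n−4. An n-tournament is k-skew-spectrally monomorphic if and only if it is switching equivalent to a transitive tournament, i.e. there exists a diagonal matrix D with diagonal entries in {1, −1} such that D·S·D is the skew-adjacency matrix of a transitive n-tournament, where S is the skew-adjacency matrix of the given tournament. -/

import Mathlib

open Polynomial Matrix

/-- An `n`-tournament given by its adjacency matrix: entries in `{0,1}`, zero diagonal,
and `A + Aᵀ = J - I` where `J` is the all-ones matrix. -/
def IsTournament {n : ℕ} (A : Matrix (Fin n) (Fin n) ℚ) : Prop :=
  (∀ i j, A i j = 0 ∨ A i j = 1) ∧ (∀ i, A i i = 0) ∧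
    A + Aᵀ = Matrix.of (fun _ _ => (1 : ℚ)) - 1

/-- Transitivity of the dominance relation. -/
def IsTransitive {n : ℕ} (A : Matrix (Fin n) (Fin n) ℚ) : Prop :=
  ∀ i j k, A i j = 1 → A j k = 1 → A i k = 1

/-- A tournament with adjacency matrix `A` is `k`-skew-spectrally monomorphic if all
`k × k` principal submatrices of its skew-adjacency matrix `S = A - Aᵀ` have the same
characteristic polynomial. -/
def SkewSpecMono {n : ℕ} (k : ℕ) (A : Matrix (Fin n) (Fin n) ℚ) : Prop :=
  ∀ f g : Fin k → Fin n, Function.Injective f → Function.Injective g →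
    ((A - Aᵀ).submatrix f f).charpoly = ((A - Aᵀ).submatrix g g).charpoly

/-- The tournament with adjacency matrix `A` is switching equivalent to a transitive
tournament: for some `±1` diagonal matrix `D`, the matrix `D·S·D` (with `S = A - Aᵀ`)
is the skew-adjacency matrix of a transitive tournament. -/
def SwitchEquivTransitive {n : ℕ} (A : Matrix (Fin n) (Fin n) ℚ) : Prop :=
  ∃ ε : Fin n → ℚ, (∀ i, ε i = 1 ∨ ε i = -1) ∧
    ∃ B : Matrix (Fin n) (Fin n) ℚ, IsTournament B ∧ IsTransitive B ∧
      Matrix.diagonal ε * (A - Aᵀ) * Matrix.diagonal ε = B - Bᵀ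

theorem gottlieb_aux {α : Type*} [DecidableEq α] :
    ∀ (t k : ℕ) (X : Finset α) (f : Finset α → ℚ), t ≤ k → k + t ≤ X.card →
      (∀ K ⊆ X, K.card = k → ∑ Q ∈ K.powersetCard t, f Q = 0) →
      ∀ Q ⊆ X, Q.card = t → f Q = 0 := by
  intro t
  induction t with
  | zero =>
    intro k X f _ hX h Q _ hQ
    obtain ⟨K, hK, hKc⟩ := Finset.exists_subset_card_eq (show k ≤ X.card by omega)
    have := h K hK hKc
    rw [Finset.card_eq_zero] at hQ
    subst hQ
    simpa using this
  | succ t ih =>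
    intro k X f htk hX h
    obtain ⟨k, rfl⟩ : ∃ k', k = k' + 1 := ⟨k - 1, by omega⟩
    have hsplit : ∀ (a : α) (K : Finset α), a ∉ K →
        ∑ Q ∈ (insert a K).powersetCard (t + 1), f Q =
          ∑ Q ∈ K.powersetCard (t + 1), f Q + ∑ P ∈ K.powersetCard t, f (insert a P) := by
      intro a K ha
      rw [Finset.powersetCard_succ_insert ha, Finset.sum_union, Finset.sum_image]
      · intro P hP P' hP' hPP
        have h1 : a ∉ P := fun h => ha ((Finset.mem_powersetCard.1 hP).1 h)
        have h2 : a ∉ P' := fun h => ha ((Finset.mem_powersetCard.1 hP').1 h)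
        rw [← Finset.erase_insert h1, ← Finset.erase_insert h2, hPP]
      · rw [Finset.disjoint_left]
        intro Q hQ hQ'
        obtain ⟨P, _, rfl⟩ := Finset.mem_image.1 hQ'
        exact ha ((Finset.mem_powersetCard.1 hQ).1 (Finset.mem_insert_self _ _))
    have hswap : ∀ a ∈ X, ∀ b ∈ X, a ≠ b → ∀ P ⊆ (X.erase a).erase b, P.card = t →
        f (insert a P) = f (insert b P) := by
      intro a ha b hb hab P hP hPc
      have hcard : ((X.erase a).erase b).card = X.card - 1 - 1 := by
        rw [Finset.card_erase_of_mem, Finset.card_erase_of_mem ha]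
        exact Finset.mem_erase.2 ⟨hab.symm, hb⟩
      have := ih k ((X.erase a).erase b) (fun P => f (insert a P) - f (insert b P))
        (by omega) (by omega) ?_ P hP hPc
      · exact sub_eq_zero.1 this
      · intro K hK hKc
        have haK : a ∉ K := fun h => by simpa using hK h
        have hbK : b ∉ K := fun h => by simpa using hK h
        have hKX : K ⊆ X := fun x hx => by
          have := hK hx
          simp only [Finset.mem_erase] at this
          exact this.2.2
        have e1 := h (insert a K) (Finset.insert_subset ha hKX)
          (by rw [Finset.card_insert_of_notMem haK, hKc])
        have e2 := h (insert b K) (Finset.insert_subset hb hKX)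
          (by rw [Finset.card_insert_of_notMem hbK, hKc])
        rw [hsplit a K haK] at e1
        rw [hsplit b K hbK] at e2
        rw [Finset.sum_sub_distrib]
        linarith
    have hconst : ∀ (m : ℕ) (Q Q' : Finset α), Q ⊆ X → Q' ⊆ X → Q.card = t + 1 →
        Q'.card = t + 1 → (Q \ Q').card = m → f Q = f Q' := by
      intro m
      induction m with
      | zero =>
        intro Q Q' _ _ h1 h2 h3
        rw [Finset.card_eq_zero, Finset.sdiff_eq_empty_iff_subset] at h3
        rw [Finset.eq_of_subset_of_card_le h3 (by omega)]
      | succ m ihm =>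
        intro Q Q' hQ hQ' h1 h2 h3
        obtain ⟨a, ha⟩ : (Q \ Q').Nonempty := Finset.card_pos.1 (by omega)
        obtain ⟨b, hb⟩ : (Q' \ Q).Nonempty := by
          apply Finset.card_pos.1
          have := Finset.card_sdiff_comm (h1.trans h2.symm)
          omega
        rw [Finset.mem_sdiff] at ha hb
        have hab : a ≠ b := fun e => hb.2 (e ▸ ha.1)
        have hbP : b ∉ Q.erase a := fun h => hb.2 (Finset.mem_of_mem_erase h)
        have e1 : f (insert a (Q.erase a)) = f (insert b (Q.erase a)) := by
          apply hswap a (hQ ha.1) b (hQ' hb.1) hab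
          · intro x hx
            have hxQ := Finset.mem_erase.1 hx
            refine Finset.mem_erase.2 ⟨fun e => hbP (e ▸ hx), Finset.mem_erase.2 ⟨hxQ.1, hQ hxQ.2⟩⟩
          · rw [Finset.card_erase_of_mem ha.1, h1]; rfl
        rw [Finset.insert_erase ha.1] at e1
        rw [e1]
        apply ihm
        · exact Finset.insert_subset (hQ' hb.1) ((Finset.erase_subset _ _).trans hQ)
        · exact hQ'
        · rw [Finset.card_insert_of_notMem hbP, Finset.card_erase_of_mem ha.1, h1]; rfl
        · exact h2
        · have : insert b (Q.erase a) \ Q' = (Q \ Q').erase a := by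
            ext x
            simp only [Finset.mem_sdiff, Finset.mem_insert, Finset.mem_erase]
            constructor
            · rintro ⟨rfl | h, h'⟩
              · exact absurd hb.1 h'
              · exact ⟨h.1, h.2, h'⟩
            · rintro ⟨h, h', h''⟩
              exact ⟨Or.inr ⟨h, h'⟩, h''⟩
          rw [this, Finset.card_erase_of_mem (Finset.mem_sdiff.2 ha), h3]; rfl
    intro Q hQ hQc
    obtain ⟨K, hK, hKc⟩ := Finset.exists_subset_card_eq (show k + 1 ≤ X.card by omega)
    have h0 := h K hK hKc
    rw [Finset.sum_congr rfl (g := fun _ => f Q) (fun Q' hQ' => by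
      obtain ⟨h1, h2⟩ := Finset.mem_powersetCard.1 hQ'
      exact hconst _ Q' Q (h1.trans hK) hQ h2 hQc rfl)] at h0
    rw [Finset.sum_const, Finset.card_powersetCard, hKc, nsmul_eq_mul] at h0
    rcases mul_eq_zero.1 h0 with h1 | h1
    · have := Nat.choose_pos (n := k + 1) (k := t + 1) htk
      have h2 : (k + 1).choose (t + 1) = 0 := by exact_mod_cast h1
      omega
    · exact h1

/-- Principal minor on a finset. -/
def pminor {n : ℕ} (S : Matrix (Fin n) (Fin n) ℚ) (Q : Finset (Fin n)) : ℚ :=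
  (S.submatrix (Subtype.val : Q → Fin n) (Subtype.val : Q → Fin n)).det

theorem pminor_of_inj {n : ℕ} {ι : Type*} [Fintype ι] [DecidableEq ι]
    (S : Matrix (Fin n) (Fin n) ℚ) (f : ι → Fin n)
    (hf : Function.Injective f) (Q : Finset (Fin n)) (hQ : ∀ x, x ∈ Q ↔ ∃ i, f i = x) :
    (S.submatrix f f).det = pminor S Q := by
  let e : ι ≃ Q := Equiv.ofBijective (fun i => ⟨f i, (hQ _).2 ⟨i, rfl⟩⟩) ⟨by
    intro i j h
    exact hf (Subtype.ext_iff.1 h), by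
    rintro ⟨x, hx⟩
    obtain ⟨i, hi⟩ := (hQ x).1 hx
    exact ⟨i, Subtype.ext hi⟩⟩
  unfold pminor
  rw [← Matrix.det_submatrix_equiv_self e, Matrix.submatrix_submatrix]
  rfl

theorem coeff_eq {n k : ℕ} (hk : 4 ≤ k) (S : Matrix (Fin n) (Fin n) ℚ) (f : Fin k ↪ Fin n) :
    ((S.submatrix f f).charpoly).coeff (k - 4) =
      ∑ Q ∈ (Finset.univ.map f).powersetCard 4, pminor S Q := by
  have := Matrix.charpoly_coeff_eq_sum_minors (S.submatrix f f) 4 (by simpa using hk)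
  rw [Fintype.card_fin] at this
  rw [this, Finset.powersetCard_map, Finset.sum_map]
  norm_num
  apply Finset.sum_congr rfl
  intro s _
  exact pminor_of_inj S (fun i : s => f i.1) (fun i j h => Subtype.ext (f.injective h)) _ (by
    intro x
    simp)

theorem minors_const {n k : ℕ} (hk : 4 ≤ k) (hkn : k + 4 ≤ n)
    (A : Matrix (Fin n) (Fin n) ℚ) (h : SkewSpecMono k A) :
    ∃ c, ∀ Q : Finset (Fin n), Q.card = 4 → pminor (A - Aᵀ) Q = c := by
  set S := A - Aᵀ with hS
  let f0 : Fin k ↪ Fin n := Fin.castLEEmb (by omega)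
  refine ⟨((S.submatrix f0 f0).charpoly).coeff (k - 4) / (k.choose 4 : ℚ), ?_⟩
  intro Q hQ
  rw [← sub_eq_zero]
  refine gottlieb_aux 4 k Finset.univ (fun Q => pminor S Q -
    ((S.submatrix f0 f0).charpoly).coeff (k - 4) / (k.choose 4 : ℚ)) hk (by simpa using hkn) ?_ Q
    (Finset.subset_univ _) hQ
  intro K _ hK
  have e := coeff_eq hk S (K.orderEmbOfFin hK).toEmbedding
  have hm : Finset.univ.map (K.orderEmbOfFin hK).toEmbedding = K := by simp
  rw [hm] at e
  have hc : (k.choose 4 : ℚ) ≠ 0 := by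
    exact_mod_cast (Nat.choose_pos hk).ne'
  rw [Finset.sum_sub_distrib, ← e, Finset.sum_const, Finset.card_powersetCard, hK, nsmul_eq_mul,
    mul_div_cancel₀ _ hc, sub_eq_zero]
  exact congrArg (fun p => Polynomial.coeff p (k - 4))
    (h _ f0 (K.orderEmbOfFin hK).injective f0.injective)

theorem det4 (S : Matrix (Fin 4) (Fin 4) ℚ) (h0 : ∀ i, S i i = 0) (h : ∀ i j, S j i = - S i j) :
    S.det = (S 0 1 * S 2 3 - S 0 2 * S 1 3 + S 0 3 * S 1 2) ^ 2 := by
  rw [Matrix.det_succ_row_zero]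
  simp only [Fin.sum_univ_four, Matrix.det_fin_three]
  simp [Fin.succAbove, h0, h 0 1, h 0 2, h 0 3, h 1 2, h 1 3, h 2 3, Fin.lt_def]
  ring

/-- Pfaffian of four vertices. -/
def pf {n : ℕ} (S : Matrix (Fin n) (Fin n) ℚ) (a b c d : Fin n) : ℚ :=
  S a b * S c d - S a c * S b d + S a d * S b c

theorem pf_sq {n : ℕ} (S : Matrix (Fin n) (Fin n) ℚ) (h0 : ∀ i, S i i = 0)
    (h : ∀ i j, S j i = - S i j) (x : ℚ) (hx : ∀ Q : Finset (Fin n), Q.card = 4 → pminor S Q = x)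
    (a b c d : Fin n) (hab : a ≠ b) (hac : a ≠ c) (had : a ≠ d) (hbc : b ≠ c) (hbd : b ≠ d)
    (hcd : c ≠ d) : pf S a b c d ^ 2 = x := by
  have e := pminor_of_inj S ![a, b, c, d] (by
    intro i j hij
    revert hij
    fin_cases i <;> fin_cases j <;>
      simp [hab, hac, had, hbc, hbd, hcd, hab.symm, hac.symm, had.symm, hbc.symm, hbd.symm, hcd.symm]) {a, b, c, d} (by
    intro y
    simp only [Fin.exists_fin_succ]
    simp [eq_comm])
  rw [hx _ (by simp [hab, hac, had, hbc, hbd, hcd]),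
    det4 (S.submatrix ![a, b, c, d] ![a, b, c, d]) (by simp [h0]) (fun i j => h _ _)] at e
  simpa [pf] using e

theorem skew_props {n : ℕ} {A : Matrix (Fin n) (Fin n) ℚ} (hT : IsTournament A) :
    (∀ i, (A - Aᵀ) i i = 0) ∧ (∀ i j, (A - Aᵀ) j i = - (A - Aᵀ) i j) ∧
    (∀ i j, i ≠ j → (A - Aᵀ) i j = 1 ∨ (A - Aᵀ) i j = -1) := by
  refine ⟨by simp, by simp, ?_⟩
  intro i j hij
  have h := congrFun (congrFun hT.2.2 i) j
  simp [Matrix.one_apply_ne hij] at h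
  rcases hT.1 i j with h1 | h1
  · right; simp; linarith
  · left; simp; linarith

theorem tri_pm (x y z a b c : ℚ) (hx : x = 1 ∨ x = -1) (hy : y = 1 ∨ y = -1)
    (hz : z = 1 ∨ z = -1) (ha : a = 1 ∨ a = -1) (hb : b = 1 ∨ b = -1) (hc : c = 1 ∨ c = -1)
    (hne : (x * a - y * b + z * c) ^ 2 ≠ 1) :
    x * y * c = y * z * a ∧ x * y * c = - (x * z * b) := by
  rcases hx with rfl | rfl <;> rcases hy with rfl | rfl <;> rcases hz with rfl | rfl <;>
  rcases ha with rfl | rfl <;> rcases hb with rfl | rfl <;> rcases hc with rfl | rfl <;>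
  first | (norm_num at hne; done) | norm_num

theorem tri_tr (x y z a b c : ℚ) (hx : x = 1 ∨ x = -1) (hy : y = 1 ∨ y = -1)
    (hz : z = 1 ∨ z = -1) (ha : a = 1 ∨ a = -1) (hb : b = 1 ∨ b = -1) (hc : c = 1 ∨ c = -1)
    (hne : (x * a - y * b + z * c) ^ 2 = 1) (h1 : x * c * y = 1) (h2 : y * a * z = 1) :
    x * b * z = 1 := by
  rcases hx with rfl | rfl <;> rcases hy with rfl | rfl <;> rcases hz with rfl | rfl <;>
  rcases ha with rfl | rfl <;> rcases hb with rfl | rfl <;> rcases hc with rfl | rfl <;>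
  first | (norm_num at hne; done) | (norm_num at h1; done) | (norm_num at h2; done) | norm_num

theorem forward {n k : ℕ} (hk : 4 ≤ k) (hkn : k + 4 ≤ n)
    (A : Matrix (Fin n) (Fin n) ℚ) (hT : IsTournament A) (h : SkewSpecMono k A) :
    SwitchEquivTransitive A := by
  obtain ⟨x, hx⟩ := minors_const hk hkn A h
  obtain ⟨h0, hs, hpm⟩ := skew_props hT
  unfold SwitchEquivTransitive
  set S := A - Aᵀ with hS
  have hpf := pf_sq S h0 hs x hx
  have hx1 : x = 1 := by
    by_contra hne
    let v : Fin 5 → Fin n := Fin.castLE (by omega)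
    have hv : ∀ i j, i ≠ j → v i ≠ v j := fun i j hij e => hij (Fin.castLE_injective _ e)
    have key : ∀ i j l : Fin 5, i ≠ 0 → j ≠ 0 → l ≠ 0 → i ≠ j → i ≠ l → j ≠ l →
        S (v 0) (v i) * S (v 0) (v j) * S (v i) (v j) =
          S (v 0) (v j) * S (v 0) (v l) * S (v j) (v l) ∧
        S (v 0) (v i) * S (v 0) (v j) * S (v i) (v j) =
          - (S (v 0) (v i) * S (v 0) (v l) * S (v i) (v l)) := by
      intro i j l hi hj hl hij hil hjl
      apply tri_pm <;> first | (apply hpm; apply hv; first | assumption | (symm; assumption)) | skip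
      have := hpf (v 0) (v i) (v j) (v l) (hv _ _ hi.symm) (hv _ _ hj.symm) (hv _ _ hl.symm)
        (hv _ _ hij) (hv _ _ hil) (hv _ _ hjl)
      unfold pf at this
      rw [this]; exact hne
    have k1 := key 1 2 3 (by decide) (by decide) (by decide) (by decide) (by decide) (by decide)
    have k2 := key 1 2 4 (by decide) (by decide) (by decide) (by decide) (by decide) (by decide)
    have k3 := key 1 3 4 (by decide) (by decide) (by decide) (by decide) (by decide) (by decide)
    have p1 := hpm _ _ (hv 0 1 (by decide))
    have p2 := hpm _ _ (hv 0 2 (by decide))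
    have p3 := hpm _ _ (hv 1 2 (by decide))
    have hz : S (v 0) (v 1) * S (v 0) (v 2) * S (v 1) (v 2) = 0 := by linarith [k1.2, k2.2, k3.2]
    rcases p1 with p1 | p1 <;> rcases p2 with p2 | p2 <;> rcases p3 with p3 | p3 <;>
      rw [p1, p2, p3] at hz <;> norm_num at hz
  rw [hx1] at hpf
  let o : Fin n := ⟨0, by omega⟩
  let ε : Fin n → ℚ := fun i => if i = o then 1 else S o i
  have hεo : ε o = 1 := if_pos rfl
  have hεn : ∀ i, i ≠ o → ε i = S o i := fun i hi => if_neg hi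
  have hε : ∀ i, ε i = 1 ∨ ε i = -1 := by
    intro i
    by_cases hi : i = o
    · left; rw [hi, hεo]
    · rw [hεn i hi]; exact hpm _ _ (Ne.symm hi)
  let T : Fin n → Fin n → ℚ := fun i j => ε i * S i j * ε j
  have hT0 : ∀ i, T i i = 0 := fun i => by simp [T, h0]
  have hTs : ∀ i j, T j i = - T i j := fun i j => by simp only [T]; rw [hs i j]; ring
  have hTpm : ∀ i j, i ≠ j → T i j = 1 ∨ T i j = -1 := by
    intro i j hij
    simp only [T]
    rcases hε i with e1 | e1 <;> rcases hε j with e2 | e2 <;> rcases hpm i j hij with e3 | e3 <;>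
      rw [e1, e2, e3] <;> norm_num
  have hTo : ∀ i, i ≠ o → T o i = 1 := by
    intro i hi
    simp only [T]
    rw [hεo, hεn i hi]
    rcases hpm o i (Ne.symm hi) with e | e <;> rw [e] <;> norm_num
  have hTtr : ∀ i j l, T i j = 1 → T j l = 1 → T i l = 1 := by
    intro i j l h1 h2
    have hij : i ≠ j := by rintro rfl; rw [hT0] at h1; norm_num at h1
    have hjl : j ≠ l := by rintro rfl; rw [hT0] at h2; norm_num at h2
    have hil : i ≠ l := by rintro rfl; rw [hTs, h1] at h2; norm_num at h2
    have hj : j ≠ o := by rintro rfl; rw [hTs, hTo i hij] at h1; norm_num at h1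
    have hl : l ≠ o := by rintro rfl; rw [hTs, hTo j hjl] at h2; norm_num at h2
    by_cases hi : i = o
    · rw [hi]; exact hTo l hl
    simp only [T] at h1 h2 ⊢
    refine tri_tr (ε i) (ε j) (ε l) (S j l) (S i l) (S i j) (hε _) (hε _) (hε _) (hpm _ _ hjl)
      (hpm _ _ hil) (hpm _ _ hij) ?_ h1 h2
    rw [hεn i hi, hεn j hj, hεn l hl]
    exact hpf o i j l (Ne.symm hi) (Ne.symm hj) (Ne.symm hl) hij hil hjl
  refine ⟨ε, hε, Matrix.of (fun i j => if T i j = 1 then 1 else 0), ⟨?_, ?_, ?_⟩, ?_, ?_⟩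
  · intro i j
    rw [Matrix.of_apply]
    split_ifs <;> simp
  · intro i
    simp [hT0]
  · ext i j
    by_cases hij : i = j
    · subst hij; simp [hT0]
    · simp only [Matrix.add_apply, Matrix.transpose_apply, Matrix.sub_apply, Matrix.of_apply,
        Matrix.one_apply_ne hij]
      rw [hTs i j]
      rcases hTpm i j hij with e | e <;> rw [e] <;> norm_num
  · intro i j l h1 h2
    have h1' : T i j = 1 := by by_contra hc; simp [hc] at h1
    have h2' : T j l = 1 := by by_contra hc; simp [hc] at h2
    simp [hTtr i j l h1' h2']
  · ext i j
    rw [Matrix.mul_diagonal, Matrix.diagonal_mul]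
    change T i j = (if T i j = 1 then 1 else 0) - (if T j i = 1 then 1 else 0)
    by_cases hij : i = j
    · subst hij; simp [hT0]
    · rw [hTs i j]
      rcases hTpm i j hij with e | e <;> rw [e] <;> norm_num

/-- The skew matrix of the standard transitive tournament. -/
def stdL (k : ℕ) : Matrix (Fin k) (Fin k) ℚ :=
  fun i j => if i < j then -1 else if j < i then 1 else 0

theorem trans_charpoly {n k : ℕ} (B : Matrix (Fin n) (Fin n) ℚ) (hB : IsTournament B)
    (htr : IsTransitive B) (f : Fin k → Fin n) (hf : Function.Injective f) :
    ((B - Bᵀ).submatrix f f).charpoly = (stdL k).charpoly := by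
  classical
  let s : Fin n → ℕ := fun i => (Finset.univ.filter (fun j => B i j = 1)).card
  have hs : ∀ i j, B i j = 1 → s j < s i := by
    intro i j hij
    apply Finset.card_lt_card
    rw [Finset.ssubset_iff_of_subset]
    · refine ⟨j, by simpa using hij, ?_⟩
      simp [hB.2.1]
    · intro l hl
      simp only [Finset.mem_filter, Finset.mem_univ, true_and] at hl ⊢
      exact htr i j l hij hl
  have hsum : ∀ i j, i ≠ j → B i j + B j i = 1 := by
    intro i j hij
    have h := congrFun (congrFun hB.2.2 i) j
    simpa [Matrix.one_apply_ne hij] using h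
  let σ := Tuple.sort (s ∘ f)
  have hmono : Monotone ((s ∘ f) ∘ σ) := Tuple.monotone_sort _
  have key : (B - Bᵀ).submatrix (f ∘ σ) (f ∘ σ) = stdL k := by
    have hlt : ∀ i j : Fin k, i < j → B (f (σ i)) (f (σ j)) = 0 ∧ B (f (σ j)) (f (σ i)) = 1 := by
      intro i j hij
      have hne : f (σ i) ≠ f (σ j) := fun e => hij.ne (σ.injective (hf e))
      have hz : B (f (σ i)) (f (σ j)) = 0 := by
        rcases hB.1 (f (σ i)) (f (σ j)) with h | h
        · exact h
        · have h1 := hs _ _ h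
          have h2 : s (f (σ i)) ≤ s (f (σ j)) := hmono hij.le
          omega
      have := hsum _ _ hne
      exact ⟨hz, by linarith⟩
    ext i j
    simp only [stdL, Matrix.submatrix_apply, Matrix.sub_apply, Matrix.transpose_apply,
      Function.comp]
    rcases lt_trichotomy i j with h | h | h
    · rw [(hlt i j h).1, (hlt i j h).2, if_pos h]; norm_num
    · subst h; simp
    · rw [(hlt j i h).1, (hlt j i h).2, if_neg h.not_gt, if_pos h]; norm_num
  rw [← key, ← Matrix.charpoly_reindex σ.symm]
  rfl

theorem backward {n k : ℕ} (A : Matrix (Fin n) (Fin n) ℚ) (h : SwitchEquivTransitive A) :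
    SkewSpecMono k A := by
  obtain ⟨ε, hε, B, hB, htr, he⟩ := h
  have main : ∀ f : Fin k → Fin n, Function.Injective f →
      ((A - Aᵀ).submatrix f f).charpoly = (stdL k).charpoly := by
    intro f hf
    rw [← trans_charpoly B hB htr f hf, ← he]
    have e1 : (Matrix.diagonal ε * (A - Aᵀ) * Matrix.diagonal ε).submatrix f f =
        Matrix.diagonal (ε ∘ f) * ((A - Aᵀ).submatrix f f * Matrix.diagonal (ε ∘ f)) := by
      ext i j
      rw [Matrix.submatrix_apply, Matrix.mul_diagonal, Matrix.diagonal_mul, Matrix.diagonal_mul,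
        Matrix.mul_diagonal]
      simp only [Matrix.submatrix_apply, Function.comp]
      ring
    have e2 : Matrix.diagonal (ε ∘ f) * Matrix.diagonal (ε ∘ f) = 1 := by
      rw [Matrix.diagonal_mul_diagonal, ← Matrix.diagonal_one]
      congr 1
      ext i
      rcases hε (f i) with e | e <;> simp [e]
    rw [e1, Matrix.charpoly_mul_comm, Matrix.mul_assoc, e2, Matrix.mul_one]
  intro f g hf hg
  rw [main f hf, main g hg]

theorem stmt_13 (n k : ℕ) (hn : 8 ≤ n) (hk4 : 4 ≤ k) (hkn : k ≤ n - 4)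
    (A : Matrix (Fin n) (Fin n) ℚ) (hT : IsTournament A) :
    SkewSpecMono k A ↔ SwitchEquivTransitive A :=
  ⟨forward hk4 (by omega) A hT, backward A⟩
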